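/- For any exact category E, the full subcategory Ac*(E) of *-bounded acyclic complexes in the homotopy category K*(E) is a thick (épaisse) triangulated subcategory, i.e., it is a triangulated subcategory closed under direct summands. -/

import Mathlib

open CategoryTheory CategoryTheory.Limits ZeroObject

universe v u

/-- The data of a class of "admissible triples" on a category: a predicate on composable
pairs of morphisms `X ⟶ Y ⟶ Z`. -/
structure ExData (C : Type u) [Category.{v} C] where
  adm : ∀ ⦃X Y Z : C⦄, (X ⟶ Y) → (Y ⟶ Z) → Prop

namespace ExData

variable {C : Type u} [Category.{v} C] [Preadditive C]

/-- A morphism is an admissible monomorphism if it is the first map of an admissible triple. -/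
def AdmMono (E : ExData C) {X Y : C} (f : X ⟶ Y) : Prop := ∃ (Z : C) (g : Y ⟶ Z), E.adm f g

/-- A morphism is an admissible epimorphism if it is the second map of an admissible triple. -/
def AdmEpi (E : ExData C) {Y Z : C} (g : Y ⟶ Z) : Prop := ∃ (X : C) (f : X ⟶ Y), E.adm f g

/-- Axiom Ex0: the zero triple is admissible and the class of admissible triples is closed
under isomorphism of triples. -/
def Ex0 [HasZeroObject C] (E : ExData C) : Prop :=
  E.adm (𝟙 (0 : C)) (𝟙 (0 : C)) ∧
  ∀ ⦃X Y Z X' Y' Z' : C⦄ (f : X ⟶ Y) (g : Y ⟶ Z) (f' : X' ⟶ Y') (g' : Y' ⟶ Z')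
    (a : X ≅ X') (b : Y ≅ Y') (c : Z ≅ Z'),
    E.adm f g → f ≫ b.hom = a.hom ≫ f' → g ≫ c.hom = b.hom ≫ g' → E.adm f' g'

/-- Axiom Ex1: in an admissible triple `X ⟶ Y ⟶ Z` the two morphisms are each other's
kernel and cokernel. -/
def Ex1 (E : ExData C) : Prop :=
  ∀ ⦃X Y Z : C⦄ (f : X ⟶ Y) (g : Y ⟶ Z), E.adm f g →
    f ≫ g = 0 ∧
    (∀ ⦃T : C⦄ (h : T ⟶ Y), h ≫ g = 0 → ∃! k : T ⟶ X, k ≫ f = h) ∧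
    (∀ ⦃T : C⦄ (h : Y ⟶ T), f ≫ h = 0 → ∃! k : Z ⟶ T, g ≫ k = h)

/-- Axiom Ex2(a): pushout of an admissible triple along a morphism out of its first term. -/
def Ex2a (E : ExData C) : Prop :=
  ∀ ⦃X' X X'' Y' : C⦄ (f : X' ⟶ X) (g : X ⟶ X''), E.adm f g → ∀ (t : X' ⟶ Y'),
    ∃ (Y : C) (i : Y' ⟶ Y) (u : X ⟶ Y) (g' : Y ⟶ X''),
      E.adm i g' ∧ t ≫ i = f ≫ u ∧ u ≫ g' = g

/-- Axiom Ex2(b): pullback of an admissible triple along a morphism into its last term. -/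
def Ex2b (E : ExData C) : Prop :=
  ∀ ⦃X' X X'' Y'' : C⦄ (f : X' ⟶ X) (g : X ⟶ X''), E.adm f g → ∀ (t : Y'' ⟶ X''),
    ∃ (Y : C) (f' : X' ⟶ Y) (u : Y ⟶ X) (g' : Y ⟶ Y''),
      E.adm f' g' ∧ f' ≫ u = f ∧ u ≫ g = g' ≫ t

/-- Axiom Ex3(a): the composition of two admissible monomorphisms is an admissible
monomorphism. -/
def Ex3a (E : ExData C) : Prop :=
  ∀ ⦃X Y Z : C⦄ (f : X ⟶ Y) (g : Y ⟶ Z), E.AdmMono f → E.AdmMono g → E.AdmMono (f ≫ g)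

/-- Axiom Ex3(b): the composition of two admissible epimorphisms is an admissible
epimorphism. -/
def Ex3b (E : ExData C) : Prop :=
  ∀ ⦃X Y Z : C⦄ (f : X ⟶ Y) (g : Y ⟶ Z), E.AdmEpi f → E.AdmEpi g → E.AdmEpi (f ≫ g)

/-- The full set of exact category axioms Ex0–Ex3. -/
structure IsExact [HasZeroObject C] (E : ExData C) : Prop where
  ex0 : E.Ex0
  ex1 : E.Ex1
  ex2a : E.Ex2a
  ex2b : E.Ex2b
  ex3a : E.Ex3a
  ex3b : E.Ex3b

end ExData

variable {C : Type u} [Category.{v} C] [Preadditive C] [HasZeroObject C]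

/-- A complex over an exact category is exact if its differentials factor as
admissible epimorphisms followed by admissible monomorphisms through a sequence of
admissible triples `Z^i → X^i → Z^{i+1}`. -/
def IsExactCpx (E : ExData C) (K : CochainComplex C ℤ) : Prop :=
  ∃ (Z : ℤ → C) (p : ∀ i : ℤ, K.X i ⟶ Z (i + 1)) (j : ∀ i : ℤ, Z i ⟶ K.X i),
    (∀ i : ℤ, E.adm (j i) (p i)) ∧ ∀ i : ℤ, K.d i (i + 1) = p i ≫ j (i + 1)

/-- A complex is acyclic if it is homotopy equivalent to an exact complex. -/
def IsAcyclicCpx (E : ExData C) (K : CochainComplex C ℤ) : Prop :=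
  ∃ L : CochainComplex C ℤ, IsExactCpx E L ∧ Nonempty (HomotopyEquiv K L)

/-- Bounded above complexes: `K.X i = 0` for `i ≫ 0`. -/
def CpxBddAbove (K : CochainComplex C ℤ) : Prop :=
  ∃ n : ℤ, ∀ i : ℤ, n ≤ i → IsZero (K.X i)

/-- Bounded below complexes: `K.X i = 0` for `i ≪ 0`. -/
def CpxBddBelow (K : CochainComplex C ℤ) : Prop :=
  ∃ n : ℤ, ∀ i : ℤ, i ≤ n → IsZero (K.X i)

/-- The class of `B`-bounded acyclic complexes, as a homotopy-invariant class of objects of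
the homotopy category `K^*(E)`. -/
def AcStar (E : ExData C) (B : CochainComplex C ℤ → Prop) (K : CochainComplex C ℤ) : Prop :=
  ∃ L : CochainComplex C ℤ, B L ∧ IsExactCpx E L ∧ Nonempty (HomotopyEquiv K L)

/-- Membership (up to homotopy equivalence) in the `B`-bounded homotopy category `K^*(E)`. -/
def InKStar (B : CochainComplex C ℤ → Prop) (K : CochainComplex C ℤ) : Prop :=
  ∃ L : CochainComplex C ℤ, B L ∧ Nonempty (HomotopyEquiv K L)

namespace ExAux

section Adm

variable {E : ExData C}

lemma adm_zero (hE : E.IsExact) {X Y Z : C} {f : X ⟶ Y} {g : Y ⟶ Z} (h : E.adm f g) :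
    f ≫ g = 0 := (hE.ex1 f g h).1

lemma adm_mono (hE : E.IsExact) {X Y Z : C} {f : X ⟶ Y} {g : Y ⟶ Z} (h : E.adm f g) :
    Mono f := by
  constructor
  intro T a b hab
  obtain ⟨k, -, hk⟩ := (hE.ex1 f g h).2.1 (a ≫ f) (by rw [Category.assoc, adm_zero hE h, comp_zero])
  rw [hk a rfl, hk b hab.symm]

lemma adm_epi (hE : E.IsExact) {X Y Z : C} {f : X ⟶ Y} {g : Y ⟶ Z} (h : E.adm f g) :
    Epi g := by
  constructor
  intro T a b hab
  obtain ⟨k, -, hk⟩ := (hE.ex1 f g h).2.2 (g ≫ a)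
    (by rw [← Category.assoc, adm_zero hE h, zero_comp])
  rw [hk a rfl, hk b hab.symm]

lemma adm_lift (hE : E.IsExact) {X Y Z : C} {f : X ⟶ Y} {g : Y ⟶ Z} (h : E.adm f g)
    {T : C} (a : T ⟶ Y) (ha : a ≫ g = 0) : ∃ k : T ⟶ X, k ≫ f = a :=
  ((hE.ex1 f g h).2.1 a ha).exists

lemma adm_desc (hE : E.IsExact) {X Y Z : C} {f : X ⟶ Y} {g : Y ⟶ Z} (h : E.adm f g)
    {T : C} (a : Y ⟶ T) (ha : f ≫ a = 0) : ∃ k : Z ⟶ T, g ≫ k = a :=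
  ((hE.ex1 f g h).2.2 a ha).exists

lemma mk_adm (hE : E.IsExact) {X Y Z : C} {f : X ⟶ Y} {g : Y ⟶ Z} (hg : E.AdmEpi g)
    (w : f ≫ g = 0) (hf : Mono f)
    (hk : ∀ (T : C) (a : T ⟶ Y), a ≫ g = 0 → ∃ k : T ⟶ X, k ≫ f = a) : E.adm f g := by
  obtain ⟨X₀, f₀, h₀⟩ := hg
  obtain ⟨a, ha⟩ := hk _ f₀ (adm_zero hE h₀)
  obtain ⟨b, hb⟩ := adm_lift hE h₀ f w
  have := adm_mono hE h₀
  let e : X₀ ≅ X := ⟨a, b, by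
    rw [← cancel_mono f₀, Category.assoc, hb, ha, Category.id_comp], by
    rw [← cancel_mono f, Category.assoc, ha, hb, Category.id_comp]⟩
  exact hE.ex0.2 f₀ g f g e (Iso.refl _) (Iso.refl _) h₀ (by simp [e, ha]) (by simp)

/-- The square of Ex2(a) is a (weak) pushout. -/
lemma po_desc (hE : E.IsExact) {X' X X'' Y' Y : C} {f : X' ⟶ X} {g : X ⟶ X''}
    (h : E.adm f g) {t : X' ⟶ Y'} {i : Y' ⟶ Y} {u : X ⟶ Y} {g' : Y ⟶ X''}
    (h' : E.adm i g') (w : t ≫ i = f ≫ u) (w' : u ≫ g' = g)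
    {W : C} (a : X ⟶ W) (b : Y' ⟶ W) (hab : f ≫ a = t ≫ b) :
    ∃ k : Y ⟶ W, u ≫ k = a ∧ i ≫ k = b := by
  obtain ⟨P, i₂, u₂, g₂, h₂, w₂, w₂'⟩ := hE.ex2a i g' h' b
  obtain ⟨k, hk⟩ := adm_desc hE h (u ≫ u₂ - a ≫ i₂) (by
    rw [Preadditive.comp_sub, ← Category.assoc, ← w, ← Category.assoc, hab, Category.assoc,
      Category.assoc, w₂, sub_self])
  have := adm_epi hE h
  have := adm_mono hE h₂
  have z₂ := adm_zero hE h₂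
  have hk1 : k ≫ g₂ = 𝟙 _ := by
    rw [← cancel_epi g, ← Category.assoc, hk, Preadditive.sub_comp, Category.assoc, Category.assoc,
      w₂', z₂, comp_zero, sub_zero, w', Category.comp_id]
  obtain ⟨ρ, hρ⟩ := adm_lift hE h₂ (𝟙 _ - g₂ ≫ k) (by
    rw [Preadditive.sub_comp, Category.assoc, hk1]; simp)
  refine ⟨u₂ ≫ ρ, ?_, ?_⟩
  · rw [← cancel_mono i₂, Category.assoc, Category.assoc, hρ, Preadditive.comp_sub,
      Preadditive.comp_sub, ← Category.assoc u₂, w₂', ← Category.assoc u g', w', hk]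
    simp
  · rw [← cancel_mono i₂, Category.assoc, Category.assoc, hρ, ← Category.assoc, ← w₂,
      Category.assoc, Preadditive.comp_sub, ← Category.assoc i₂, z₂]
    simp

lemma po_ext (hE : E.IsExact) {X' X X'' Y' Y : C} {f : X' ⟶ X} {g : X ⟶ X''}
    (h : E.adm f g) {i : Y' ⟶ Y} {u : X ⟶ Y} {g' : Y ⟶ X''}
    (h' : E.adm i g') (w' : u ≫ g' = g)
    {W : C} {a b : Y ⟶ W} (h1 : u ≫ a = u ≫ b) (h2 : i ≫ a = i ≫ b) : a = b := by
  have := adm_epi hE h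
  obtain ⟨k, hk⟩ := adm_desc hE h' (a - b) (by rw [Preadditive.comp_sub, h2, sub_self])
  have : k = 0 := by
    rw [← cancel_epi g, ← w', Category.assoc, hk, Preadditive.comp_sub, h1, sub_self, comp_zero]
  rw [← sub_eq_zero, ← hk, this, comp_zero]

/-- The square of Ex2(b) is a (weak) pullback. -/
lemma pb_lift (hE : E.IsExact) {X' X X'' Y Y'' : C} {f : X' ⟶ X} {g : X ⟶ X''}
    (h : E.adm f g) {t : Y'' ⟶ X''} {f' : X' ⟶ Y} {u : Y ⟶ X} {g' : Y ⟶ Y''}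
    (h' : E.adm f' g') (w : f' ≫ u = f) (w' : u ≫ g = g' ≫ t)
    {T : C} (a : T ⟶ X) (b : T ⟶ Y'') (hab : a ≫ g = b ≫ t) :
    ∃ k : T ⟶ Y, k ≫ u = a ∧ k ≫ g' = b := by
  obtain ⟨P, f₂, u₂, g₂, h₂, w₂, w₂'⟩ := hE.ex2b f' g' h' b
  obtain ⟨k, hk⟩ := adm_lift hE h (u₂ ≫ u - g₂ ≫ a) (by
    rw [Preadditive.sub_comp, Category.assoc, Category.assoc, w', hab, ← Category.assoc, w₂',
      Category.assoc, sub_self])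
  have := adm_mono hE h
  have := adm_epi hE h₂
  have z₂ := adm_zero hE h₂
  have hk1 : f₂ ≫ k = 𝟙 _ := by
    rw [← cancel_mono f, Category.assoc, hk, Preadditive.comp_sub, ← Category.assoc,
      ← Category.assoc, w₂, z₂, zero_comp, sub_zero, w, Category.id_comp]
  obtain ⟨ρ, hρ⟩ := adm_desc hE h₂ (𝟙 _ - k ≫ f₂) (by
    rw [Preadditive.comp_sub, ← Category.assoc, hk1]; simp)
  refine ⟨ρ ≫ u₂, ?_, ?_⟩
  · rw [← cancel_epi g₂, ← Category.assoc, ← Category.assoc, hρ, Preadditive.sub_comp,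
      Preadditive.sub_comp, Category.assoc k, w₂, Category.assoc k, w, hk]
    simp
  · rw [← cancel_epi g₂, ← Category.assoc, ← Category.assoc, hρ, Category.assoc, w₂',
      Preadditive.sub_comp, Category.assoc, ← Category.assoc f₂, z₂]
    simp

lemma pb_ext (hE : E.IsExact) {X' X X'' Y Y'' : C} {f : X' ⟶ X} {g : X ⟶ X''}
    (h : E.adm f g) {f' : X' ⟶ Y} {u : Y ⟶ X} {g' : Y ⟶ Y''}
    (h' : E.adm f' g') (w : f' ≫ u = f)
    {T : C} {a b : T ⟶ Y} (h1 : a ≫ u = b ≫ u) (h2 : a ≫ g' = b ≫ g') : a = b := by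
  have := adm_mono hE h
  obtain ⟨k, hk⟩ := adm_lift hE h' (a - b) (by rw [Preadditive.sub_comp, h2, sub_self])
  have : k = 0 := by
    rw [← cancel_mono f, ← w, ← Category.assoc, hk, Preadditive.sub_comp, h1, sub_self, zero_comp]
  rw [← sub_eq_zero, ← hk, this, zero_comp]

lemma admEpi_iso (hE : E.IsExact) {Y Y' Z : C} (g : Y ⟶ Z) (hg : E.AdmEpi g) (e : Y ≅ Y')
    (g' : Y' ⟶ Z) (w : g = e.hom ≫ g') : E.AdmEpi g' := by
  obtain ⟨X, f, h⟩ := hg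
  exact ⟨X, f ≫ e.hom, hE.ex0.2 f g _ _ (Iso.refl _) e (Iso.refl _) h (by simp) (by simp [w])⟩

/-- Pullbacks of admissible epimorphisms are admissible epimorphisms. -/
lemma admEpi_pb (hE : E.IsExact) {P Y W Z : C} {u : P ⟶ Y} {g' : P ⟶ W} {g : Y ⟶ Z} {t : W ⟶ Z}
    (hg : E.AdmEpi g) (w : u ≫ g = g' ≫ t)
    (hl : ∀ (T : C) (a : T ⟶ Y) (b : T ⟶ W), a ≫ g = b ≫ t → ∃ k : T ⟶ P, k ≫ u = a ∧ k ≫ g' = b)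
    (hx : ∀ (T : C) (k : T ⟶ P), k ≫ u = 0 → k ≫ g' = 0 → k = 0) : E.AdmEpi g' := by
  obtain ⟨X, f, h⟩ := hg
  obtain ⟨Q, f₁, u₁, g₁, h₁, w₁, w₁'⟩ := hE.ex2b f g h t
  obtain ⟨m, hm, hm'⟩ := hl Q u₁ g₁ w₁'
  obtain ⟨n, hn, hn'⟩ := pb_lift hE h h₁ w₁ w₁' u g' w
  let e : Q ≅ P := ⟨m, n, by
    apply pb_ext hE h h₁ w₁ <;> simp [*], by
    rw [← sub_eq_zero]
    apply hx <;> simp [*]⟩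
  exact admEpi_iso hE g₁ ⟨_, _, h₁⟩ e g' hm'.symm

lemma adm_to_zero (hE : E.IsExact) (W : C) : E.AdmEpi (0 : W ⟶ (0 : C)) := by
  obtain ⟨Y, i, u, g', h, -, -⟩ := hE.ex2a _ _ hE.ex0.1 (0 : (0 : C) ⟶ W)
  have := adm_mono hE h
  obtain ⟨k, hk⟩ := adm_lift hE h (𝟙 _) ((isZero_zero C).eq_of_tgt _ _)
  exact admEpi_iso hE g' ⟨_, _, h⟩ ⟨k, i, hk, by
    rw [← cancel_mono i, Category.assoc, hk]; simp⟩ _ ((isZero_zero C).eq_of_tgt _ _)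

/-- Split triples are admissible. -/
lemma adm_split (hE : E.IsExact) {X Y Z : C} {f : X ⟶ Y} {g : Y ⟶ Z} (r : Y ⟶ X) (s : Z ⟶ Y)
    (h1 : f ≫ r = 𝟙 _) (h2 : s ≫ g = 𝟙 _) (h3 : f ≫ g = 0) (h4 : r ≫ f + g ≫ s = 𝟙 _) :
    E.adm f g := by
  have h5 : s ≫ r = 0 := by
    have : s ≫ r = s ≫ (r ≫ f + g ≫ s) ≫ r := by rw [h4]; simp
    simp only [Preadditive.add_comp, Preadditive.comp_add, Category.assoc, h1] at this
    rw [← Category.assoc s g, h2] at this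
    simpa using this
  apply mk_adm hE
  · apply admEpi_pb hE (adm_to_zero hE X) (u := r) (g' := g) (t := 0)
    · simp
    · intro T a b _
      refine ⟨a ≫ f + b ≫ s, ?_, ?_⟩ <;> simp [*]
    · intro T k hk hk'
      rw [← Category.comp_id k, ← h4, Preadditive.comp_add, ← Category.assoc, hk,
        ← Category.assoc, hk']
      simp
  · exact h3
  · exact ⟨fun a b hab => by simpa [h1] using hab =≫ r⟩
  · intro T a ha
    refine ⟨a ≫ r, ?_⟩
    have : a = a ≫ (r ≫ f + g ≫ s) := by rw [h4]; simp
    rw [Preadditive.comp_add, ← Category.assoc a g, ha] at this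
    rw [Category.assoc]
    simpa using this.symm

lemma admEpi_map_id [HasBinaryBiproducts C] (hE : E.IsExact) {Y Z : C} {g : Y ⟶ Z}
    (hg : E.AdmEpi g) (W : C) : E.AdmEpi (biprod.map g (𝟙 W)) := by
  apply admEpi_pb hE hg (u := biprod.fst) (t := biprod.fst)
  · simp
  · intro T a b hab
    exact ⟨biprod.lift a (b ≫ biprod.snd), by simp, by ext <;> simp [hab]⟩
  · intro T k hk hk'
    ext
    · simpa using hk
    · simpa using hk' =≫ biprod.snd

lemma admEpi_id_map [HasBinaryBiproducts C] (hE : E.IsExact) {Y Z : C} {g : Y ⟶ Z}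
    (hg : E.AdmEpi g) (W : C) : E.AdmEpi (biprod.map (𝟙 W) g) := by
  apply admEpi_pb hE hg (u := biprod.snd) (t := biprod.snd)
  · simp
  · intro T a b hab
    exact ⟨biprod.lift (b ≫ biprod.fst) a, by simp, by ext <;> simp [hab]⟩
  · intro T k hk hk'
    ext
    · simpa using hk' =≫ biprod.fst
    · simpa using hk

lemma admEpi_map [HasBinaryBiproducts C] (hE : E.IsExact) {Y Z Y' Z' : C} {g : Y ⟶ Z}
    {g' : Y' ⟶ Z'} (hg : E.AdmEpi g) (hg' : E.AdmEpi g') : E.AdmEpi (biprod.map g g') := by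
  have : biprod.map g g' = biprod.map g (𝟙 _) ≫ biprod.map (𝟙 _) g' := by ext <;> simp
  rw [this]
  exact hE.ex3b _ _ (admEpi_map_id hE hg _) (admEpi_id_map hE hg' _)

lemma adm_map [HasBinaryBiproducts C] (hE : E.IsExact) {X Y Z X' Y' Z' : C} {f : X ⟶ Y}
    {g : Y ⟶ Z} {f' : X' ⟶ Y'} {g' : Y' ⟶ Z'} (h : E.adm f g) (h' : E.adm f' g') :
    E.adm (biprod.map f f') (biprod.map g g') := by
  have := adm_mono hE h
  have := adm_mono hE h'
  refine mk_adm hE (admEpi_map hE ⟨_, _, h⟩ ⟨_, _, h'⟩) ?_ ⟨?_⟩ ?_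
  · ext <;> simp [adm_zero hE h, adm_zero hE h']
  · intro T a b hab
    have h1 : (a ≫ biprod.fst) ≫ f = (b ≫ biprod.fst) ≫ f := by simpa using hab =≫ biprod.fst
    have h2 : (a ≫ biprod.snd) ≫ f' = (b ≫ biprod.snd) ≫ f' := by simpa using hab =≫ biprod.snd
    rw [cancel_mono] at h1 h2
    ext <;> assumption
  · intro T a ha
    have h1 := ha =≫ biprod.fst
    have h2 := ha =≫ biprod.snd
    simp only [Category.assoc, biprod.map_fst, biprod.map_snd, zero_comp] at h1 h2
    obtain ⟨k, hk⟩ := adm_lift hE h (a ≫ biprod.fst) (by simpa using h1)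
    obtain ⟨l, hl⟩ := adm_lift hE h' (a ≫ biprod.snd) (by simpa using h2)
    exact ⟨biprod.lift k l, by ext <;> simp [hk, hl]⟩

/-- If `(i, g')` is admissible and `u ≫ g'` is an admissible epimorphism then so is `(u, i)`. -/
lemma admEpi_desc [HasBinaryBiproducts C] (hE : E.IsExact) {X X'' Y Y' : C} {i : Y' ⟶ Y}
    {g' : Y ⟶ X''} {u : X ⟶ Y} (h : E.adm i g') (hu : E.AdmEpi (u ≫ g')) :
    E.AdmEpi (biprod.desc u i) := by
  have := adm_mono hE h
  have z := adm_zero hE h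
  apply admEpi_pb hE hu (u := biprod.fst) (t := g')
  · ext <;> simp [z]
  · intro T a b hab
    obtain ⟨k, hk⟩ := adm_lift hE h (b - a ≫ u) (by simp [hab])
    exact ⟨biprod.lift a k, by simp, by simp [hk]⟩
  · intro T k hk hk'
    have : k = biprod.lift 0 (k ≫ biprod.snd) := by ext <;> simp [hk]
    rw [this] at hk' ⊢
    simp only [biprod.lift_desc, zero_comp, zero_add] at hk'
    rw [← zero_comp (X := T) (f := i), cancel_mono] at hk'
    rw [hk']
    ext <;> simp

end Adm

set_option linter.unusedSectionVars false

section Cpx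

variable {E : ExData C}

/-- Decomposition data for an exact complex, with flexible indices. -/
structure Dec (E : ExData C) (K : CochainComplex C ℤ) where
  Z : ℤ → C
  j : ∀ i : ℤ, Z i ⟶ K.X i
  p : ∀ i k : ℤ, i + 1 = k → (K.X i ⟶ Z k)
  adm : ∀ (i k : ℤ) (h : i + 1 = k), E.adm (j i) (p i k h)
  d : ∀ (i k : ℤ) (h : i + 1 = k), K.d i k = p i k h ≫ j k

lemma Dec.isExactCpx {K : CochainComplex C ℤ} (D : Dec E K) : IsExactCpx E K :=
  ⟨D.Z, fun i => D.p i _ rfl, D.j, fun i => D.adm i _ rfl, fun i => D.d i _ rfl⟩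

lemma exists_dec {K : CochainComplex C ℤ} (h : IsExactCpx E K) : Nonempty (Dec E K) := by
  obtain ⟨Z, p, j, h1, h2⟩ := h
  exact ⟨{ Z := Z, j := j
           p := fun i k h => p i ≫ eqToHom (by rw [h])
           adm := by rintro i _ rfl; simpa using h1 i
           d := by rintro i _ rfl; simpa using h2 i }⟩

lemma adm_neg (hE : E.IsExact) {X Y Z : C} {f : X ⟶ Y} {g : Y ⟶ Z} (h : E.adm f g) :
    E.adm f (-g) :=
  hE.ex0.2 f g f (-g) (Iso.refl _) (Iso.refl _) ⟨-𝟙 _, -𝟙 _, by simp, by simp⟩ h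
    (by simp) (by simp)

lemma adm_units (hE : E.IsExact) {X Y Z : C} {f : X ⟶ Y} {g : Y ⟶ Z} (h : E.adm f g) (ε : ℤˣ) :
    E.adm f (ε • g) := by
  rcases Int.units_eq_one_or ε with rfl | rfl
  · simpa using h
  · simpa using adm_neg hE h

lemma exact_shift (hE : E.IsExact) {K : CochainComplex C ℤ} (hK : IsExactCpx E K) (n : ℤ) :
    IsExactCpx E (K⟦n⟧) := by
  obtain ⟨D⟩ := exists_dec hK
  exact Dec.isExactCpx
    { Z := fun i => D.Z (i + n)
      j := fun i => D.j (i + n)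
      p := fun i k h => n.negOnePow • D.p (i + n) (k + n) (by lia)
      adm := fun i k h => adm_units hE (D.adm _ _ _) _
      d := fun i k h => by
        dsimp
        rw [D.d (i + n) (k + n) (by lia), Linear.units_smul_comp] }

lemma exact_biprod [HasBinaryBiproducts C] (hE : E.IsExact) {K L : CochainComplex C ℤ}
    (hK : IsExactCpx E K) (hL : IsExactCpx E L) : IsExactCpx E (K ⊞ L) := by
  obtain ⟨D⟩ := exists_dec hK
  obtain ⟨D'⟩ := exists_dec hL
  exact Dec.isExactCpx
    { Z := fun i => D.Z i ⊞ D'.Z i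
      j := fun i => biprod.map (D.j i) (D'.j i) ≫ (HomologicalComplex.biprodXIso K L i).inv
      p := fun i k h => (HomologicalComplex.biprodXIso K L i).hom ≫
        biprod.map (D.p i k h) (D'.p i k h)
      adm := fun i k h => hE.ex0.2 _ _ _ _ (Iso.refl _) (HomologicalComplex.biprodXIso K L i).symm
        (Iso.refl _) (adm_map hE (D.adm i k h) (D'.adm i k h)) (by simp) (by simp)
      d := fun i k h => by
        rw [Category.assoc, ← Iso.inv_comp_eq, ← Category.assoc]
        apply biprod.hom_ext'
        · simp [D.d i k h]
        · simp [D'.d i k h] }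

open CochainComplex in
lemma exact_cone_id [HasBinaryBiproducts C] (hE : E.IsExact) (K : CochainComplex C ℤ) :
    IsExactCpx E (mappingCone (𝟙 K)) := by
  apply Dec.isExactCpx
  refine
    { Z := fun i => K.X i
      j := fun i => (mappingCone.inr (𝟙 K)).f i -
        K.d i (i + 1) ≫ (mappingCone.inl (𝟙 K)).v (i + 1) i (by lia)
      p := fun i k h => (mappingCone.fst (𝟙 K)).1.v i k h +
        (mappingCone.snd (𝟙 K)).v i i (by lia) ≫ K.d i k
      adm := ?_
      d := ?_ }
  · rintro i _ rfl
    refine adm_split hE ((mappingCone.snd (𝟙 K)).v i i (by lia))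
      ((mappingCone.inl (𝟙 K)).v (i + 1) i (by lia)) ?_ ?_ ?_ ?_
    · simp
    · simp
    · simp
    · rw [← mappingCone.id_X (𝟙 K) i _ rfl]
      simp only [Preadditive.comp_sub, Preadditive.add_comp, Category.assoc]
      abel
  · rintro i _ rfl
    rw [mappingCone.ext_to_iff _ _ _ rfl, mappingCone.d_fst_v _ _ _ _ rfl rfl,
      mappingCone.d_snd_v _ _ _ rfl]
    constructor <;> simp

open CochainComplex in
lemma exact_cone [HasBinaryBiproducts C] (hE : E.IsExact) {K L : CochainComplex C ℤ} (f : K ⟶ L)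
    (hK : IsExactCpx E K) (hL : IsExactCpx E L) : IsExactCpx E (mappingCone f) := by
  obtain ⟨A⟩ := exists_dec hK
  obtain ⟨B⟩ := exists_dec hL
  have hφ : ∀ i, ∃ φ : A.Z i ⟶ B.Z i, φ ≫ B.j i = A.j i ≫ f.f i := by
    intro i
    apply adm_lift hE (B.adm i _ rfl)
    have := adm_mono hE (B.adm _ _ (rfl : i + 1 + 1 = _))
    rw [← cancel_mono (B.j (i + 1)), Category.assoc, ← B.d, Category.assoc, f.comm,
      A.d _ _ rfl, ← Category.assoc, ← Category.assoc, adm_zero hE (A.adm i _ rfl)]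
    simp
  choose φ hφ using hφ
  have hφ' : ∀ i k h, A.p i k h ≫ φ k = f.f i ≫ B.p i k h := by
    intro i k h
    have := adm_mono hE (B.adm k _ rfl)
    rw [← cancel_mono (B.j k), Category.assoc, hφ, ← Category.assoc, ← A.d, Category.assoc,
      ← B.d, f.comm]
  have hW : ∀ i, ∃ (W : C) (ι : B.Z i ⟶ W) (b : W ⟶ L.X i) (a : W ⟶ A.Z (i + 1)),
      E.adm ι a ∧ ι ≫ b = B.j i ∧ b ≫ B.p i (i + 1) rfl = a ≫ φ (i + 1) :=
    fun i => hE.ex2b _ _ (B.adm i _ rfl) (φ (i + 1))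
  choose W ι b a hW hb ha using hW
  have hu : ∀ i k (h : i + 1 = k), ∃ u : K.X i ⟶ W i, u ≫ b i = f.f i ∧
      u ≫ a i = A.p i (i + 1) rfl := fun i k h =>
    pb_lift hE (B.adm i _ rfl) (hW i) (hb i) (ha i) _ _ (hφ' _ _ _).symm
  replace hu := fun i => hu i _ rfl
  choose u hub hua using hu
  have hju : ∀ i, A.j i ≫ u i = φ i ≫ ι i := by
    intro i
    apply pb_ext hE (B.adm i _ rfl) (hW i) (hb i)
    · simp [hub, hb, hφ]
    · simp [hua, adm_zero hE (A.adm _ _ _), adm_zero hE (hW i)]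
  apply Dec.isExactCpx
  refine
    { Z := W
      j := fun i => - a i ≫ A.j (i + 1) ≫ (mappingCone.inl f).v (i + 1) i (by lia) +
        b i ≫ (mappingCone.inr f).f i
      p := fun i k h => (mappingCone.fst f).1.v i k h ≫ u k +
        (mappingCone.snd f).v i i (by lia) ≫ B.p i k h ≫ ι k
      adm := ?_
      d := ?_ }
  · rintro i _ rfl
    apply mk_adm hE
    · have h1 := hE.ex3b _ _ (admEpi_id_map hE ⟨_, _, B.adm i _ rfl⟩ (K.X (i + 1)))
        (admEpi_desc hE (hW (i + 1)) (u := u (i + 1)) (by rw [hua]; exact ⟨_, _, A.adm _ _ _⟩))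
      refine admEpi_iso hE _ h1
        ⟨biprod.desc ((mappingCone.inl f).v (i + 1) i (by lia)) ((mappingCone.inr f).f i),
        biprod.lift ((mappingCone.fst f).1.v i _ rfl) ((mappingCone.snd f).v i i (by lia)), ?_, ?_⟩
        _ ?_
      · ext <;> simp
      · simp [mappingCone.id_X]
      · ext <;> simp
    · simp [hju, reassoc_of% (ha i)]
    · constructor
      intro T x y hxy
      rw [mappingCone.ext_to_iff _ _ _ rfl] at hxy
      have := adm_mono hE (A.adm (i + 1) _ rfl)
      apply pb_ext hE (B.adm i _ rfl) (hW i) (hb i)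
      · simpa using hxy.2
      · rw [← cancel_mono (A.j (i + 1))]
        simpa using hxy.1
    · intro T x hx
      obtain ⟨y, z, rfl⟩ := mappingCone.decomp_to f x _ rfl
      simp at hx
      have hy : y ≫ A.p (i + 1) _ rfl = 0 := by
        simpa [hua, adm_zero hE (hW _)] using hx =≫ a _
      obtain ⟨y', rfl⟩ := adm_lift hE (A.adm _ _ _) _ hy
      have := adm_mono hE (hW (i + 1))
      obtain ⟨k, hk, hk'⟩ := pb_lift hE (B.adm i _ rfl) (hW i) (hb i) (ha i) z (-y') (by
        rw [← cancel_mono (ι (i + 1)), ← sub_eq_zero]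
        simpa [hju, add_comm] using hx)
      refine ⟨k, ?_⟩
      rw [mappingCone.ext_to_iff _ _ _ rfl]
      constructor
      · simp [reassoc_of% hk']
      · simp [hk]
  · rintro i _ rfl
    rw [mappingCone.ext_to_iff _ _ _ rfl, mappingCone.d_fst_v _ _ _ _ rfl rfl,
      mappingCone.d_snd_v _ _ _ rfl]
    constructor
    · simp [reassoc_of% hua, A.d _ _ rfl, reassoc_of% (adm_zero hE (hW (i + 1)))]
    · simp [hub, hb, B.d _ _ rfl]

end Cpx

section Retract

variable {E : ExData C}

/-- A strict retract of an exact complex is homotopy equivalent to an exact complex. -/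
lemma retract_core (hE : E.IsExact) {K L : CochainComplex C ℤ} (D : Dec E L)
    (s : K ⟶ L) (r : L ⟶ K) (hsr : s ≫ r = 𝟙 K) :
    ∃ M : CochainComplex C ℤ, IsExactCpx E M ∧ (∀ i, IsZero (L.X i) → IsZero (M.X i)) ∧
      Nonempty (HomotopyEquiv K M) := by
  have hsr' : ∀ i, s.f i ≫ r.f i = 𝟙 _ := fun i => by
    rw [← HomologicalComplex.comp_f, hsr, HomologicalComplex.id_f]
  have jmono : ∀ i, Mono (D.j i) := fun i => adm_mono hE (D.adm i _ rfl)
  have pepi : ∀ i k h, Epi (D.p i k h) := fun i k h => adm_epi hE (D.adm i _ h)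
  have jp : ∀ i k h, D.j i ≫ D.p i k h = 0 := fun i k h => adm_zero hE (D.adm i _ h)
  have he : ∀ i, ∃ e : D.Z i ⟶ D.Z i, e ≫ D.j i = D.j i ≫ r.f i ≫ s.f i := by
    intro i
    apply adm_lift hE (D.adm i _ rfl)
    rw [← cancel_mono (D.j (i + 1))]
    simp only [Category.assoc, zero_comp]
    rw [← D.d, s.comm, r.comm_assoc, D.d _ _ rfl, Category.assoc, reassoc_of% (jp i _ rfl),
      zero_comp]
  choose e he using he
  have hep : ∀ i k h, D.p i k h ≫ e k = r.f i ≫ s.f i ≫ D.p i k h := by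
    intro i k h
    rw [← cancel_mono (D.j k)]
    simp only [Category.assoc]
    rw [he, ← D.d i k h, ← reassoc_of% (D.d i k h), s.comm, r.comm_assoc]
  have hee : ∀ i, e i ≫ e i = e i := by
    intro i
    rw [← cancel_mono (D.j i), Category.assoc, he, reassoc_of% (he i), reassoc_of% (hsr' i)]
  have hX : ∀ i, ∃ (X : C) (j' : D.Z i ⟶ X) (u : L.X i ⟶ X) (p' : X ⟶ D.Z (i + 1)),
      E.adm j' p' ∧ e i ≫ j' = D.j i ≫ u ∧ u ≫ p' = D.p i _ rfl :=
    fun i => hE.ex2a _ _ (D.adm i _ rfl) (e i)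
  choose X j' u p₀ hadm hju hup using hX
  have hz : ∀ i, j' i ≫ p₀ i = 0 := fun i => adm_zero hE (hadm i)
  let M : CochainComplex C ℤ := CochainComplex.of X (fun i => p₀ i ≫ j' (i + 1))
    (fun i => by simp [reassoc_of% (hz (i + 1))])
  have Md : ∀ i, M.d i (i + 1) = p₀ i ≫ j' (i + 1) := fun i => by
    simpa [M] using CochainComplex.of_d X (fun i => p₀ i ≫ j' (i + 1)) i
  have ext : ∀ i {W : C} {a b : X i ⟶ W}, u i ≫ a = u i ≫ b → j' i ≫ a = j' i ≫ b → a = b :=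
    fun i {W a b} => po_ext hE (D.adm i _ rfl) (hadm i) (hup i)
  have desc : ∀ i {W : C} (a : L.X i ⟶ W) (b : D.Z i ⟶ W), D.j i ≫ a = e i ≫ b →
      ∃ k : X i ⟶ W, u i ≫ k = a ∧ j' i ≫ k = b :=
    fun i {W} a b => po_desc hE (D.adm i _ rfl) (hadm i) (hju i) (hup i) a b
  have hv : ∀ i, ∃ v : X i ⟶ K.X i, u i ≫ v = r.f i ∧ j' i ≫ v = D.j i ≫ r.f i := fun i =>
    desc i _ _ (by rw [reassoc_of% (he i), hsr']; simp)
  choose v huv hjv using hv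
  have hq : ∀ i, ∃ q : X i ⟶ D.Z i, u i ≫ q = 0 ∧ j' i ≫ q = 𝟙 _ - e i := fun i =>
    desc i _ _ (by simp [hee])
  choose q huq hjq using hq
  have ht : ∀ i, ∃ t : D.Z (i + 1) ⟶ X i, D.p i _ rfl ≫ t = u i - r.f i ≫ s.f i ≫ u i := fun i =>
    adm_desc hE (D.adm i _ rfl) _ (by
      rw [Preadditive.comp_sub, ← hju, ← reassoc_of% (he i), ← hju, reassoc_of% (hee i), sub_self])
  choose t ht using ht
  have htp : ∀ i, t i ≫ p₀ i = 𝟙 _ - e (i + 1) := by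
    intro i
    rw [← cancel_epi (D.p i _ rfl), reassoc_of% (ht i), Preadditive.comp_sub, hep]
    simp [hup]
  have het : ∀ i, e (i + 1) ≫ t i = 0 := by
    intro i
    rw [← cancel_epi (D.p i _ rfl), reassoc_of% (hep i _ rfl), ht]
    simp [reassoc_of% (hsr' i)]
  let φ : K ⟶ M :=
    { f := fun i => s.f i ≫ u i
      comm' := by
        rintro i _ rfl
        rw [Md, ← reassoc_of% (s.comm i (i + 1)), D.d i _ rfl]
        simp only [Category.assoc]
        rw [← hju, reassoc_of% (hep i _ rfl), reassoc_of% (hsr' i), reassoc_of% (hup i)] }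
  let ψ : M ⟶ K :=
    { f := fun i => v i
      comm' := by
        rintro i _ rfl
        rw [Md]
        apply ext i
        · rw [reassoc_of% (huv i), Category.assoc, reassoc_of% (hup i), hjv, r.comm, D.d _ _ rfl,
            Category.assoc]
        · rw [reassoc_of% (hjv i), Category.assoc, reassoc_of% (hz i), r.comm, D.d _ _ rfl,
            Category.assoc, reassoc_of% (jp i _ rfl)]
          simp }
  refine ⟨M, ⟨D.Z, p₀, j', hadm, Md⟩, ?_, ⟨⟨φ, ψ, Homotopy.ofEq ?_, ?_⟩⟩⟩
  · intro i hi
    have h1 : IsZero (D.Z i) := by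
      rw [IsZero.iff_id_eq_zero, ← cancel_mono (D.j i)]
      exact hi.eq_of_tgt _ _
    have h2 : IsZero (D.Z (i + 1)) := by
      rw [IsZero.iff_id_eq_zero, ← cancel_epi (D.p i _ rfl)]
      exact hi.eq_of_src _ _
    change IsZero (X i)
    rw [IsZero.iff_id_eq_zero]
    apply ext i
    · exact hi.eq_of_src _ _
    · exact h1.eq_of_src _ _
  · ext i
    simp [φ, ψ, huv, hsr']
  · let H : ∀ i k : ℤ, (ComplexShape.up ℤ).Rel k i → (M.X i ⟶ M.X k) := fun i k h =>
      q i ≫ eqToHom (by rw [← (h : k + 1 = i)]) ≫ t k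
    have key : 𝟙 M - ψ ≫ φ = Homotopy.nullHomotopicMap' H := by
      ext k
      obtain ⟨i, rfl⟩ : ∃ i, k = i + 1 := ⟨k - 1, by lia⟩
      rw [Homotopy.nullHomotopicMap'_f (k₂ := i) (k₁ := i + 1) (k₀ := i + 1 + 1) rfl rfl, Md, Md]
      simp only [H, φ, ψ, HomologicalComplex.sub_f_apply, HomologicalComplex.id_f,
        HomologicalComplex.comp_f, eqToHom_refl, Category.id_comp, Category.assoc]
      change 𝟙 (X (i + 1)) - _ = _
      apply ext
      · simp only [Preadditive.comp_sub, Preadditive.comp_add, Category.comp_id,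
          reassoc_of% huv, reassoc_of% hup, reassoc_of% hjq, reassoc_of% huq,
          reassoc_of% htp, Preadditive.sub_comp, Category.id_comp, het, ht, zero_comp,
          comp_zero, sub_zero, add_zero]
      · simp only [Preadditive.comp_sub, Preadditive.comp_add, Category.comp_id,
          reassoc_of% hjv, reassoc_of% hz, reassoc_of% hjq,
          reassoc_of% htp, Preadditive.sub_comp, Category.id_comp, zero_comp,
          comp_zero, zero_add, ← reassoc_of% he, ← hju, reassoc_of% hee, sub_self, sub_zero]
    exact (((Homotopy.equivSubZero).symm
      ((Homotopy.ofEq key).trans (Homotopy.nullHomotopy' H)))).symm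

end Retract

section Final

variable {E : ExData C}

/-- The boundedness conditions considered here only depend on the vanishing of terms. -/
lemma bdd_of {B : CochainComplex C ℤ → Prop}
    (hB : B = (fun _ => True) ∨ B = CpxBddAbove (C := C) ∨ B = CpxBddBelow (C := C) ∨
      B = fun K => CpxBddAbove K ∧ CpxBddBelow K)
    {K L M : CochainComplex C ℤ} (hK : B K) (hL : B L)
    (h : ∀ i, (∀ k, i - 1 ≤ k → k ≤ i + 1 → IsZero (K.X k)) →
      (∀ k, i - 1 ≤ k → k ≤ i + 1 → IsZero (L.X k)) → IsZero (M.X i)) : B M := by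
  have h1 : CpxBddAbove K → CpxBddAbove L → CpxBddAbove M := by
    rintro ⟨a, ha⟩ ⟨b, hb⟩
    exact ⟨max a b + 1, fun i hi => h i (fun k _ _ => ha k (by lia)) (fun k _ _ => hb k (by lia))⟩
  have h2 : CpxBddBelow K → CpxBddBelow L → CpxBddBelow M := by
    rintro ⟨a, ha⟩ ⟨b, hb⟩
    exact ⟨min a b - 1, fun i hi => h i (fun k _ _ => ha k (by lia)) (fun k _ _ => hb k (by lia))⟩
  rcases hB with rfl | rfl | rfl | rfl
  · trivial
  · exact h1 hK hL
  · exact h2 hK hL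
  · exact ⟨h1 hK.1 hL.1, h2 hK.2 hL.2⟩

lemma bdd_zero {B : CochainComplex C ℤ → Prop}
    (hB : B = (fun _ => True) ∨ B = CpxBddAbove (C := C) ∨ B = CpxBddBelow (C := C) ∨
      B = fun K => CpxBddAbove K ∧ CpxBddBelow K) : B 0 := by
  have h : ∀ i, IsZero ((0 : CochainComplex C ℤ).X i) := fun i =>
    (HomologicalComplex.eval C (ComplexShape.up ℤ) i).map_isZero (isZero_zero _)
  have h1 : CpxBddAbove (0 : CochainComplex C ℤ) := ⟨0, fun i _ => h i⟩
  have h2 : CpxBddBelow (0 : CochainComplex C ℤ) := ⟨0, fun i _ => h i⟩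
  rcases hB with rfl | rfl | rfl | rfl
  · trivial
  · exact h1
  · exact h2
  · exact ⟨h1, h2⟩

lemma exact_zero (hE : E.IsExact) : IsExactCpx E (0 : CochainComplex C ℤ) := by
  have h : ∀ i, IsZero ((0 : CochainComplex C ℤ).X i) := fun i =>
    (HomologicalComplex.eval C (ComplexShape.up ℤ) i).map_isZero (isZero_zero _)
  exact ⟨fun _ => 0, fun _ => 0, fun _ => 0, fun i => hE.ex0.2 _ _ _ _ (Iso.refl _)
    ((isZero_zero C).iso (h i)) (Iso.refl _) hE.ex0.1 ((h i).eq_of_tgt _ _)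
    ((isZero_zero C).eq_of_tgt _ _), fun i => (h i).eq_of_src _ _⟩

lemma shift_equiv {K L : CochainComplex C ℤ} (e : HomotopyEquiv K L) (n : ℤ) :
    Nonempty (HomotopyEquiv (K⟦n⟧) (L⟦n⟧)) := by
  let Q := HomotopyCategory.quotient C (ComplexShape.up ℤ)
  let i : Q.obj K ≅ Q.obj L := HomotopyCategory.isoOfHomotopyEquiv e
  exact ⟨HomotopyCategory.homotopyEquivOfIso
    ((Q.commShiftIso n).app K ≪≫ (shiftFunctor _ n).mapIso i ≪≫ ((Q.commShiftIso n).app L).symm)⟩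

lemma cone_equiv [HasBinaryBiproducts C] {K L K' L' : CochainComplex C ℤ} (e : HomotopyEquiv K K')
    (e' : HomotopyEquiv L L') (f : K ⟶ L) :
    Nonempty (HomotopyEquiv (CochainComplex.mappingCone f)
      (CochainComplex.mappingCone (e.inv ≫ f ≫ e'.hom))) := by
  let i := HomotopyCategory.isoOfHomotopyEquiv e
  let i' := HomotopyCategory.isoOfHomotopyEquiv e'
  let T := Pretriangulated.isoTriangleOfIso₁₂ _ _
    (HomotopyCategory.mappingCone_triangleh_distinguished f)
    (HomotopyCategory.mappingCone_triangleh_distinguished (e.inv ≫ f ≫ e'.hom)) i i' (by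
      have : i.hom ≫ i.inv = 𝟙 _ := i.hom_inv_id
      change (HomotopyCategory.quotient _ _).map f ≫ i'.hom = i.hom ≫
        (HomotopyCategory.quotient _ _).map (e.inv ≫ f ≫ e'.hom)
      rw [Functor.map_comp, Functor.map_comp]
      change _ = i.hom ≫ i.inv ≫ _ ≫ i'.hom
      rw [Iso.hom_inv_id_assoc])
  exact ⟨HomotopyCategory.homotopyEquivOfIso (Pretriangulated.Triangle.π₃.mapIso T)⟩

/-- Homotopy retracts are strict retracts after adding a contractible complex. -/
lemma strictify [HasBinaryBiproducts C] {K L : CochainComplex C ℤ} (s : K ⟶ L) (r : L ⟶ K)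
    (h : Homotopy (s ≫ r) (𝟙 K)) :
    ∃ (s' : K ⟶ L ⊞ CochainComplex.mappingCone (𝟙 K))
      (r' : L ⊞ CochainComplex.mappingCone (𝟙 K) ⟶ K), s' ≫ r' = 𝟙 K := by
  refine ⟨biprod.lift s (CochainComplex.mappingCone.inr _), biprod.desc r
    (CochainComplex.mappingCone.desc _ (CochainComplex.HomComplex.Cochain.ofHomotopy h.symm)
      (𝟙 K - s ≫ r) (by simp)), by simp⟩

end Final

end ExAux

/-- For any exact category `E` and any boundedness condition `*` among
{unbounded, bounded above, bounded below, bounded}, the full subcategory `Ac^*(E)` of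
`*`-bounded acyclic complexes is a thick triangulated subcategory of the homotopy category
`K^*(E)`: it contains the zero complex, is closed under shifts in both directions, is
closed under extensions (cones of morphisms), and is closed under direct summands
(retracts in the homotopy category). -/
theorem stmt_6 [HasBinaryBiproducts C] (E : ExData C) (hE : E.IsExact)
    (B : CochainComplex C ℤ → Prop)
    (hB : B = (fun _ => True) ∨ B = CpxBddAbove (C := C) ∨ B = CpxBddBelow (C := C) ∨
      B = fun K => CpxBddAbove K ∧ CpxBddBelow K) :
    AcStar E B (0 : CochainComplex C ℤ) ∧
    (∀ K : CochainComplex C ℤ, AcStar E B K →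
      AcStar E B (K⟦(1 : ℤ)⟧) ∧ AcStar E B (K⟦(-1 : ℤ)⟧)) ∧
    (∀ (K L : CochainComplex C ℤ) (f : K ⟶ L), AcStar E B K → AcStar E B L →
      AcStar E B (CochainComplex.mappingCone f)) ∧
    (∀ (K L : CochainComplex C ℤ) (s : K ⟶ L) (r : L ⟶ K),
      Nonempty (Homotopy (s ≫ r) (𝟙 K)) → InKStar B K → AcStar E B L → AcStar E B K) := by
  refine ⟨⟨0, ExAux.bdd_zero hB, ExAux.exact_zero hE, ⟨HomotopyEquiv.refl _⟩⟩, ?_, ?_, ?_⟩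
  · rintro K ⟨L, hL, hL', ⟨e⟩⟩
    refine ⟨⟨L⟦(1 : ℤ)⟧, ?_, ExAux.exact_shift hE hL' 1, ExAux.shift_equiv e 1⟩,
      ⟨L⟦(-1 : ℤ)⟧, ?_, ExAux.exact_shift hE hL' (-1), ExAux.shift_equiv e (-1)⟩⟩
    · exact ExAux.bdd_of hB hL hL (fun i h _ => h (i + 1) (by lia) (by lia))
    · exact ExAux.bdd_of hB hL hL (fun i h _ => h (i + -1) (by lia) (by lia))
  · rintro K L f ⟨K', hK, hK', ⟨e⟩⟩ ⟨L', hL, hL', ⟨e'⟩⟩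
    refine ⟨CochainComplex.mappingCone (e.inv ≫ f ≫ e'.hom), ?_, ExAux.exact_cone hE _ hK' hL',
      ExAux.cone_equiv e e' f⟩
    refine ExAux.bdd_of hB hK hL (fun i h h' => ?_)
    rw [CochainComplex.mappingCone.isZero_X_iff]
    exact ⟨h (i + 1) (by lia) (by lia), h' i (by lia) (by lia)⟩
  · rintro K L s r ⟨h⟩ ⟨K', hK', ⟨e⟩⟩ ⟨L', hL', hL'', ⟨e'⟩⟩
    have hr : Homotopy ((e.inv ≫ s ≫ e'.hom) ≫ (e'.inv ≫ r ≫ e.hom)) (𝟙 K') := by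
      refine (Homotopy.ofEq ?_).trans
        ((((((e'.homotopyHomInvId.compRight r).compLeft s).trans
          (Homotopy.ofEq (by simp))).trans h).compRight e.hom).compLeft e.inv |>.trans
          ((Homotopy.ofEq (by simp)).trans e.homotopyInvHomId))
      simp
    obtain ⟨s', r', hsr⟩ := ExAux.strictify _ _ hr
    obtain ⟨D⟩ := ExAux.exists_dec (ExAux.exact_biprod hE hL'' (ExAux.exact_cone_id hE K'))
    obtain ⟨M, hM, hM', ⟨e''⟩⟩ := ExAux.retract_core hE D s' r' hsr
    refine ⟨M, ?_, hM, ⟨e.trans e''⟩⟩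
    refine ExAux.bdd_of hB hK' hL' (fun i h1 h2 => hM' i ?_)
    refine IsZero.of_iso ?_ (HomologicalComplex.biprodXIso _ _ i)
    rw [biprod_isZero_iff, CochainComplex.mappingCone.isZero_X_iff]
    exact ⟨h2 i (by lia) (by lia), h1 (i + 1) (by lia) (by lia), h1 i (by lia) (by lia)⟩
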